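/- Let δ ∈ [0,2), let r_0 > 0, and let C : Ω → Sym_d(ℝ) be a matrix-valued function with real Lipschitz entries and C(x) positive-definite for each x ∈ Ω. Let c : Ω → ℝ be a bounded Lipschitz function with c(x) ≥ μ > 0 for all x ∈ Γ_{r_0}, and assume the boundary condition inf_{r ∈ (0,r_0]} sup_{x ∈ Γ_r} ‖C(x) d_Γ(x)^{−δ} − c(x) I‖ = 0. Define h(φ) = ∫_Ω ⟨C(x)(∇φ)(x), (∇φ)(x)⟩ dx for φ ∈ C_c^∞(Ω). Then the following are equivalent: (I) there exist r > 0 and a > 0 such that the boundary Hardy inequality with constant a holds on Γ_r; (II) there exist β > 0 and γ ≥ 0 such that β ∫_Ω c d_Γ^{δ−2} |φ|^2 ≤ h(φ) + γ‖φ‖_2^2 for all φ ∈ C_c^∞(Ω). Moreover, if these conditions hold then the supremum of the β > 0 for which (II) holds equals a_δ(Γ)^{−2}. -/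

import Mathlib

open MeasureTheory Metric Set ENNReal RealInnerProductSpace

noncomputable section

/-- The Euclidean distance from `x` to the boundary `Γ = ∂Ω` of `Ω`. -/
def distB {d : ℕ} (Ω : Set (EuclideanSpace ℝ (Fin d))) (x : EuclideanSpace ℝ (Fin d)) : ℝ :=
  Metric.infDist x (frontier Ω)

/-- The boundary layer `Γ_r = {x ∈ Ω : d_Γ(x) < r}`. -/
def bdryLayer {d : ℕ} (Ω : Set (EuclideanSpace ℝ (Fin d))) (r : ℝ) :
    Set (EuclideanSpace ℝ (Fin d)) :=
  {x | x ∈ Ω ∧ distB Ω x < r}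

/-- `C_c^1` real functions with compact support contained in `U`. -/
def IsCc1 {d : ℕ} (U : Set (EuclideanSpace ℝ (Fin d)))
    (ψ : EuclideanSpace ℝ (Fin d) → ℝ) : Prop :=
  ContDiff ℝ 1 ψ ∧ HasCompactSupport ψ ∧ tsupport ψ ⊆ U

/-- The `L²` norm with respect to Lebesgue measure. -/
def L2N {d : ℕ} (f : EuclideanSpace ℝ (Fin d) → ℝ) : ℝ≥0∞ :=
  eLpNorm f 2 volume

/-- The weighted norm `‖d_Γ^p ψ‖₂`. -/
def wNorm {d : ℕ} (Ω : Set (EuclideanSpace ℝ (Fin d))) (p : ℝ)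
    (ψ : EuclideanSpace ℝ (Fin d) → ℝ) : ℝ≥0∞ :=
  L2N (fun x => distB Ω x ^ p * ψ x)

/-- The weighted gradient norm `‖d_Γ^p |∇ψ|‖₂`. -/
def wGradNorm {d : ℕ} (Ω : Set (EuclideanSpace ℝ (Fin d))) (p : ℝ)
    (ψ : EuclideanSpace ℝ (Fin d) → ℝ) : ℝ≥0∞ :=
  L2N (fun x => distB Ω x ^ p * ‖fderiv ℝ ψ x‖)

/-- The (boundary) Hardy inequality `‖d_Γ^{δ/2-1}ψ‖₂ ≤ a ‖d_Γ^{δ/2}|∇ψ|‖₂`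
with constant `a` for all test functions `ψ ∈ C_c^1(S)`. -/
def BHardy {d : ℕ} (Ω : Set (EuclideanSpace ℝ (Fin d))) (δ : ℝ)
    (S : Set (EuclideanSpace ℝ (Fin d))) (a : ℝ) : Prop :=
  ∀ ψ, IsCc1 S ψ → wNorm Ω (δ/2 - 1) ψ ≤ ENNReal.ofReal a * wGradNorm Ω (δ/2) ψ

/-- The weak Hardy inequality `‖d_Γ^{δ/2-1}ψ‖₂ ≤ b ‖d_Γ^{δ/2}|∇ψ|‖₂ + c ‖ψ‖₂`
with constants `b, c` for all test functions `ψ ∈ C_c^1(S)`. -/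
def WHardy {d : ℕ} (Ω : Set (EuclideanSpace ℝ (Fin d))) (δ : ℝ)
    (S : Set (EuclideanSpace ℝ (Fin d))) (b c : ℝ) : Prop :=
  ∀ ψ, IsCc1 S ψ →
    wNorm Ω (δ/2 - 1) ψ ≤ ENNReal.ofReal b * wGradNorm Ω (δ/2) ψ + ENNReal.ofReal c * L2N ψ

/-- The optimal Hardy constant for test functions supported in `S`
(the infimum of the `a > 0` for which the Hardy inequality holds on `S`;
`∞` if there is no such constant). -/
def hardyConstS {d : ℕ} (Ω : Set (EuclideanSpace ℝ (Fin d))) (δ : ℝ)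
    (S : Set (EuclideanSpace ℝ (Fin d))) : ℝ≥0∞ :=
  sInf {t | ∃ a : ℝ, 0 < a ∧ t = ENNReal.ofReal a ∧ BHardy Ω δ S a}

/-- The boundary Hardy constant `a_δ(Γ) = inf_{r>0} a_δ(Γ_r)`. -/
def hardyConst {d : ℕ} (Ω : Set (EuclideanSpace ℝ (Fin d))) (δ : ℝ) : ℝ≥0∞ :=
  ⨅ (r : ℝ) (_ : 0 < r), hardyConstS Ω δ (bdryLayer Ω r)

/-- The local boundary Hardy constant `a_δ(Γ ∩ U) = inf_{r>0} a_δ(Γ_r ∩ U)`. -/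
def hardyConstOn {d : ℕ} (Ω : Set (EuclideanSpace ℝ (Fin d))) (δ : ℝ)
    (U : Set (EuclideanSpace ℝ (Fin d))) : ℝ≥0∞ :=
  ⨅ (r : ℝ) (_ : 0 < r), hardyConstS Ω δ (bdryLayer Ω r ∩ U)

/-- The weak Hardy constant `b_δ(Ω)`: the infimum of the `b > 0` for which there
is a `c > 0` such that the weak Hardy inequality holds on `Ω`. -/
def weakConstDomain {d : ℕ} (Ω : Set (EuclideanSpace ℝ (Fin d))) (δ : ℝ) : ℝ≥0∞ :=
  sInf {t | ∃ b c : ℝ, 0 < b ∧ 0 < c ∧ t = ENNReal.ofReal b ∧ WHardy Ω δ Ω b c}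

/-- The weak Hardy constant `b_δ(Γ)`: the infimum of the `b > 0` for which there
are `r > 0` and `c > 0` such that the weak Hardy inequality holds on `Γ_r`. -/
def weakConstBdry {d : ℕ} (Ω : Set (EuclideanSpace ℝ (Fin d))) (δ : ℝ) : ℝ≥0∞ :=
  sInf {t | ∃ b c r : ℝ, 0 < b ∧ 0 < c ∧ 0 < r ∧ t = ENNReal.ofReal b ∧
    WHardy Ω δ (bdryLayer Ω r) b c}

/-- The weak Hardy constant `b_δ(Γ ∩ U)`. -/
def weakConstOn {d : ℕ} (Ω : Set (EuclideanSpace ℝ (Fin d))) (δ : ℝ)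
    (U : Set (EuclideanSpace ℝ (Fin d))) : ℝ≥0∞ :=
  sInf {t | ∃ b c r : ℝ, 0 < b ∧ 0 < c ∧ 0 < r ∧ t = ENNReal.ofReal b ∧
    WHardy Ω δ (bdryLayer Ω r ∩ U) b c}

/-- A domain: a nonempty open connected proper subset of `ℝ^d`. -/
def IsDomainSet {d : ℕ} (Ω : Set (EuclideanSpace ℝ (Fin d))) : Prop :=
  IsOpen Ω ∧ IsConnected Ω ∧ Ω ≠ Set.univ

/-- `C_c^∞` real functions with compact support contained in `U`. -/
def IsCcInf {d : ℕ} (U : Set (EuclideanSpace ℝ (Fin d)))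
    (ψ : EuclideanSpace ℝ (Fin d) → ℝ) : Prop :=
  ContDiff ℝ (⊤ : ℕ∞) ψ ∧ HasCompactSupport ψ ∧ tsupport ψ ⊆ U

section Mollification

variable {E : Type*} [NormedAddCommGroup E] [NormedSpace ℝ E] [HasContDiffBump E]
  [FiniteDimensional ℝ E]

/-- A Lipschitz function has smooth mollifications with the same Lipschitz bound, whose values
lie in every closed ball containing the nearby values of the function. -/
theorem LipschitzWith.exists_mollification {f : E → ℝ} {K : NNReal} (hf : LipschitzWith K f)
    {ε : ℝ} (hε : 0 < ε) :
    ∃ u : E → ℝ, ContDiff ℝ (⊤ : ℕ∞) u ∧ (∀ x, ‖fderiv ℝ u x‖ ≤ K) ∧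
      ∀ x z r, 0 ≤ r → (∀ y ∈ ball x ε, |f y - z| ≤ r) → |u x - z| ≤ r := by
  borelize E
  set ν : Measure E := Measure.addHaar
  set b : ContDiffBump (0 : E) := ⟨ε / 2, ε, half_pos hε, half_lt_self hε⟩
  have hli : LocallyIntegrable f ν := hf.continuous.locallyIntegrable
  refine ⟨convolution (b.normed ν) f (ContinuousLinearMap.lsmul ℝ ℝ) ν,
    b.hasCompactSupport_normed.contDiff_convolution_left _ b.contDiff_normed hli,
    fun x => norm_fderiv_le_of_lipschitz ℝ (LipschitzWith.of_dist_le_mul fun x y => ?_),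
    fun x z r hr h => ?_⟩
  · have hex := (b.hasCompactSupport_normed (μ := ν)).convolutionExists_left
      (ContinuousLinearMap.lsmul ℝ ℝ) (b.continuous_normed (μ := ν)) hli
    rw [dist_eq_norm, convolution_def, convolution_def, ← integral_sub (hex x) (hex y)]
    have hint : Integrable (b.normed ν) ν :=
      (b.continuous_normed (μ := ν)).integrable_of_hasCompactSupport b.hasCompactSupport_normed
    calc _ ≤ ∫ t, b.normed ν t * (K * dist x y) ∂ν := by
          refine norm_integral_le_of_norm_le (hint.mul_const _) (.of_forall fun t => ?_)
          simp only [ContinuousLinearMap.lsmul_apply, ← smul_sub, norm_smul,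
            Real.norm_of_nonneg (b.nonneg_normed t)]
          refine mul_le_mul_of_nonneg_left ?_ (b.nonneg_normed t)
          simpa [dist_eq_norm] using hf.dist_le_mul (x - t) (y - t)
      _ = K * dist x y := by rw [integral_mul_const, b.integral_normed (μ := ν), one_mul]
  · exact dist_convolution_le hr b.support_normed_eq.subset b.nonneg_normed b.integral_normed
      hf.continuous.aestronglyMeasurable h

/-- Mollification of a `C¹` function with compact support: the values of the mollification and of
its derivative lie in every closed ball containing the nearby values of the function, respectively
of its derivative. -/
theorem ContDiff.exists_mollification {f : E → ℝ} (hf : ContDiff ℝ 1 f)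
    (hc : HasCompactSupport f) {ε : ℝ} (hε : 0 < ε) :
    ∃ u : E → ℝ, ContDiff ℝ (⊤ : ℕ∞) u ∧
      (∀ x z r, 0 ≤ r → (∀ y ∈ ball x ε, Dist.dist (f y) z ≤ r) → Dist.dist (u x) z ≤ r) ∧
      ∀ x z r, 0 ≤ r → (∀ y ∈ ball x ε, Dist.dist (fderiv ℝ f y) z ≤ r) →
        Dist.dist (fderiv ℝ u x) z ≤ r := by
  borelize E
  set ν : Measure E := Measure.addHaar
  set b : ContDiffBump (0 : E) := ⟨ε / 2, ε, half_pos hε, half_lt_self hε⟩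
  refine ⟨convolution (b.normed ν) f (ContinuousLinearMap.lsmul ℝ ℝ) ν,
    b.hasCompactSupport_normed.contDiff_convolution_left _ b.contDiff_normed
      hf.continuous.locallyIntegrable, fun x z r hr h => ?_, fun x z r hr h => ?_⟩
  · exact dist_convolution_le hr b.support_normed_eq.subset b.nonneg_normed b.integral_normed
      hf.continuous.aestronglyMeasurable h
  · have hd := hc.hasFDerivAt_convolution_right (μ := ν) (ContinuousLinearMap.lsmul ℝ ℝ)
      (b.continuous_normed (μ := ν)).locallyIntegrable hf x
    have heq : (convolution (b.normed ν) (fderiv ℝ f)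
        ((ContinuousLinearMap.lsmul ℝ ℝ).precompR E) ν) x =
        (convolution (b.normed ν) (fderiv ℝ f) (ContinuousLinearMap.lsmul ℝ ℝ) ν) x := by
      simp only [convolution_def]
      congr 1
    rw [hd.fderiv, heq]
    exact dist_convolution_le hr b.support_normed_eq.subset b.nonneg_normed b.integral_normed
      (hf.continuous_fderiv one_ne_zero).aestronglyMeasurable h

/-- A smooth cutoff adapted to the sublevel sets of a Lipschitz function. -/
theorem LipschitzWith.exists_smooth_cutoff {f : E → ℝ} (hf : LipschitzWith 1 f) {s : ℝ}
    (hs : 0 < s) :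
    ∃ χ : E → ℝ, ContDiff ℝ (⊤ : ℕ∞) χ ∧ (∃ K : ℝ, ∀ x, ‖fderiv ℝ χ x‖ ≤ K) ∧
      (∀ x, 0 ≤ χ x ∧ χ x ≤ 1) ∧ (∀ x, f x ≤ s → χ x = 1) ∧ ∀ x, 3 * s ≤ f x → χ x = 0 := by
  set F : E → ℝ := fun x => max 0 (min 1 (5 / 2 - s⁻¹ * f x)) with hF
  have hFl : LipschitzWith ⟨s⁻¹, by positivity⟩ F := by
    have h1 : LipschitzWith ⟨s⁻¹, by positivity⟩ (fun x => 5 / 2 - s⁻¹ * f x) := by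
      refine LipschitzWith.of_dist_le_mul fun x y => ?_
      have h := hf.dist_le_mul x y
      simp only [NNReal.coe_one, one_mul, Real.dist_eq] at h
      rw [Real.dist_eq, show 5 / 2 - s⁻¹ * f x - (5 / 2 - s⁻¹ * f y) = -(s⁻¹ * (f x - f y)) by ring,
        abs_neg, abs_mul, abs_of_pos (by positivity : 0 < s⁻¹)]
      exact mul_le_mul_of_nonneg_left h (by positivity)
    exact (h1.const_min 1).const_max 0
  obtain ⟨u, hu, huK, huP⟩ := hFl.exists_mollification (half_pos hs)
  have hnear : ∀ x, ∀ y ∈ ball x (s / 2), |f y - f x| ≤ s / 2 := fun x y hy => by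
    have h := hf.dist_le_mul y x
    simp only [NNReal.coe_one, one_mul, Real.dist_eq] at h
    exact h.trans (mem_ball.1 hy).le
  refine ⟨u, hu, ⟨_, huK⟩, fun x => ?_, fun x hx => ?_, fun x hx => ?_⟩
  · have h := huP x (1 / 2) (1 / 2) (by norm_num) fun y _ => by
      rw [abs_le]
      exact ⟨by linarith [le_max_left 0 (min 1 (5 / 2 - s⁻¹ * f y))],
        by linarith [max_le zero_le_one (min_le_left 1 (5 / 2 - s⁻¹ * f y))]⟩
    rw [abs_le] at h
    constructor <;> linarith
  · have h := huP x 1 0 le_rfl fun y hy => by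
      have h1 := (abs_le.1 (hnear x y hy)).2
      have h2 : s⁻¹ * f y ≤ 3 / 2 := by
        rw [inv_mul_le_iff₀ hs]; linarith
      simp only [hF]
      rw [min_eq_left (by linarith), max_eq_right zero_le_one]
      simp
    linarith [abs_nonpos_iff.1 h]
  · have h := huP x 0 0 le_rfl fun y hy => by
      have h1 := (abs_le.1 (hnear x y hy)).1
      have h2 : 5 / 2 ≤ s⁻¹ * f y := by
        rw [le_inv_mul_iff₀ hs]; linarith
      simp only [hF]
      rw [min_eq_right (by linarith), max_eq_left (by linarith)]
      simp
    linarith [abs_nonpos_iff.1 h]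

/-- A Lipschitz function with values in `[μ, M]`, `0 < μ`, on a set `S` can be compared on `S`,
up to a factor `t > 1`, with the square of a smooth function with bounded gradient. -/
theorem LipschitzOnWith.exists_smooth_sqrt {c : E → ℝ} {S : Set E} {L : NNReal}
    (hc : LipschitzOnWith L c S) {μ M : ℝ} (hμ : 0 < μ) (hcS : ∀ x ∈ S, μ ≤ c x ∧ c x ≤ M)
    {t : ℝ} (ht : 1 < t) :
    ∃ u : E → ℝ, ContDiff ℝ (⊤ : ℕ∞) u ∧ (∃ K : ℝ, ∀ x, ‖fderiv ℝ u x‖ ≤ K) ∧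
      (∃ B : ℝ, ∀ x, u x ≤ B) ∧ (∃ m > 0, ∀ x, m ≤ u x) ∧
      ∀ x ∈ S, c x ≤ t * u x ^ 2 ∧ u x ^ 2 ≤ t * c x := by
  obtain ⟨e, he, hec⟩ := hc.extend_real
  set g : E → ℝ := fun x => √(max μ (min (max M μ) (e x))) with hg
  have hm : 0 < √μ := Real.sqrt_pos.2 hμ
  have hgm : ∀ x, √μ ≤ g x := fun x => Real.sqrt_le_sqrt (le_max_left _ _)
  have hgM : ∀ x, g x ≤ √(max M μ) := fun x =>
    Real.sqrt_le_sqrt (max_le (le_max_right _ _) (min_le_left _ _))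
  have hgl : LipschitzWith (L / Real.toNNReal √μ) g := by
    have h1 : LipschitzWith L (fun x => max μ (min (max M μ) (e x))) :=
      (he.const_min _).const_max _
    refine LipschitzWith.of_dist_le_mul fun x y => ?_
    have h := h1.dist_le_mul x y
    have hp : ∀ z, g z ^ 2 = max μ (min (max M μ) (e z)) := fun z =>
      Real.sq_sqrt (hμ.le.trans (le_max_left _ _))
    rw [Real.dist_eq, ← hp, ← hp, sq_sub_sq, abs_mul] at h
    rw [Real.dist_eq, NNReal.coe_div, Real.coe_toNNReal _ hm.le, div_mul_eq_mul_div, le_div_iff₀ hm]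
    refine le_trans ?_ h
    rw [mul_comm]
    refine mul_le_mul_of_nonneg_right ?_ (abs_nonneg _)
    exact (by linarith [hgm x, hgm y] : √μ ≤ g x + g y).trans (le_abs_self _)
  have hst : 1 < √t := by rw [Real.lt_sqrt zero_le_one]; simpa using ht
  set η : ℝ := √μ * (√t - 1) with hη
  have hη0 : 0 < η := mul_pos hm (by linarith)
  obtain ⟨u, hu, huK, huP⟩ := hgl.exists_mollification
    (ε := η / ((L / Real.toNNReal √μ : NNReal) + 1 : ℝ)) (by positivity)
  have hum : ∀ x, √μ ≤ u x ∧ u x ≤ √(max M μ) := fun x => by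
    have h := huP x ((√μ + √(max M μ)) / 2) ((√(max M μ) - √μ) / 2)
      (by linarith [hgm x, hgM x]) fun y _ => by
        rw [abs_le]; constructor <;> linarith [hgm y, hgM y]
    rw [abs_le] at h
    constructor <;> linarith
  have hug : ∀ x, |u x - g x| ≤ η := fun x => huP x _ _ hη0.le fun y hy => by
    have h := hgl.dist_le_mul y x
    rw [Real.dist_eq] at h
    refine h.trans ?_
    have hy' := (mem_ball.1 hy).le
    rw [le_div_iff₀ (by positivity)] at hy'
    nlinarith [dist_nonneg (x := y) (y := x)]
  refine ⟨u, hu, ⟨_, huK⟩, ⟨_, fun x => (hum x).2⟩, ⟨_, hm, fun x => (hum x).1⟩, fun x hx => ?_⟩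
  have hcx := hcS x hx
  have hgc : g x ^ 2 = c x := by
    rw [hg]
    simp only
    rw [Real.sq_sqrt (hμ.le.trans (le_max_left _ _)), ← hec hx,
      min_eq_right (hcx.2.trans (le_max_left _ _)), max_eq_right hcx.1]
  have h := abs_le.1 (hug x)
  have ht2 : √t ^ 2 = t := Real.sq_sqrt (by linarith)
  rw [← hgc, ← ht2, ← mul_pow, ← mul_pow]
  have hgx := hgm x
  have hux := (hum x).1
  constructor <;> refine pow_le_pow_left₀ (by linarith) ?_ 2
  · nlinarith
  · nlinarith

end Mollification

section Integration

variable {X : Type*} [TopologicalSpace X] [MeasurableSpace X] [OpensMeasurableSpace X] [T2Space X]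
  {ν : Measure X} [IsFiniteMeasureOnCompacts ν]

theorem ContinuousOn.integrableOn_of_eqOn_zero_compl {f : X → ℝ} {U K : Set X}
    (hf : ContinuousOn f U) (hU : MeasurableSet U) (hK : IsCompact K) (hKU : K ⊆ U)
    (h0 : ∀ x ∉ K, f x = 0) : IntegrableOn f U ν :=
  (((hf.mono hKU).integrableOn_compact hK).of_forall_sdiff_eq_zero hU fun x hx => h0 x hx.2)

theorem tendsto_setIntegral_of_eqOn_zero_compl {F : ℕ → X → ℝ} {f w : X → ℝ} {U K : Set X}
    (hF : ∀ n, ContinuousOn (F n) U) (hw : ContinuousOn w U) (hU : MeasurableSet U)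
    (hK : IsCompact K) (hKU : K ⊆ U) (h0 : ∀ n, ∀ x ∉ K, F n x = 0)
    (hb : ∀ n, ∀ x ∈ U, |F n x| ≤ w x)
    (hlim : ∀ x, Filter.Tendsto (fun n => F n x) Filter.atTop (nhds (f x))) :
    Filter.Tendsto (fun n => ∫ x in U, F n x ∂ν) Filter.atTop (nhds (∫ x in U, f x ∂ν)) := by
  refine tendsto_integral_of_dominated_convergence (K.indicator w)
    (fun n => ((hF n).integrableOn_of_eqOn_zero_compl hU hK hKU (h0 n)).aestronglyMeasurable)
    ?_ (fun n => ?_) (.of_forall hlim)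
  · exact ((integrable_indicator_iff hK.measurableSet).2
      ((hw.mono hKU).integrableOn_compact hK)).integrableOn
  · refine (ae_restrict_iff' hU).2 (.of_forall fun x hx => ?_)
    by_cases hxK : x ∈ K
    · simpa [hxK] using hb n x hx
    · simp [hxK, h0 n x hxK]

end Integration

section Hardy

variable {d : ℕ} {Ω : Set (EuclideanSpace ℝ (Fin d))}

theorem IsCc1.mono {U V : Set (EuclideanSpace ℝ (Fin d))} {ψ : EuclideanSpace ℝ (Fin d) → ℝ}
    (h : IsCc1 U ψ) (hUV : U ⊆ V) : IsCc1 V ψ :=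
  ⟨h.1, h.2.1, h.2.2.trans hUV⟩

theorem IsCcInf.isCc1 {U : Set (EuclideanSpace ℝ (Fin d))} {ψ : EuclideanSpace ℝ (Fin d) → ℝ}
    (h : IsCcInf U ψ) : IsCc1 U ψ :=
  ⟨h.1.of_le (by exact_mod_cast le_top), h.2⟩

theorem bdryLayer_subset (r : ℝ) : bdryLayer Ω r ⊆ Ω := fun _ hx => hx.1

theorem bdryLayer_mono {r s : ℝ} (h : r ≤ s) : bdryLayer Ω r ⊆ bdryLayer Ω s :=
  fun _ hx => ⟨hx.1, hx.2.trans_le h⟩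

theorem lipschitzWith_distB : LipschitzWith 1 (distB Ω) :=
  Metric.lipschitz_infDist_pt _

theorem distB_nonneg (x : EuclideanSpace ℝ (Fin d)) : 0 ≤ distB Ω x :=
  Metric.infDist_nonneg

theorem distB_pos (hΩ : IsDomainSet Ω) {x : EuclideanSpace ℝ (Fin d)} (hx : x ∈ Ω) :
    0 < distB Ω x := by
  have hne : (frontier Ω).Nonempty := by
    by_contra h
    rw [Set.not_nonempty_iff_eq_empty, frontier_eq_empty_iff] at h
    exact h.elim (hΩ.2.1.nonempty.ne_empty) hΩ.2.2
  refine (isClosed_frontier.notMem_iff_infDist_pos hne).1 fun h => ?_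
  rw [hΩ.1.frontier_eq] at h
  exact h.2 hx

theorem continuousOn_distB_rpow (hΩ : IsDomainSet Ω) (p : ℝ) :
    ContinuousOn (fun x => distB Ω x ^ p) Ω :=
  lipschitzWith_distB.continuous.continuousOn.rpow_const fun _ hx => Or.inl (distB_pos hΩ hx).ne'

theorem norm_gradient_eq (φ : EuclideanSpace ℝ (Fin d) → ℝ) (x : EuclideanSpace ℝ (Fin d)) :
    ‖gradient φ x‖ = ‖fderiv ℝ φ x‖ := by
  simp [gradient]

theorem IsCc1.eq_zero {φ : EuclideanSpace ℝ (Fin d) → ℝ} {x : EuclideanSpace ℝ (Fin d)}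
    (hx : x ∉ tsupport φ) : φ x = 0 ∧ fderiv ℝ φ x = 0 :=
  ⟨image_eq_zero_of_notMem_tsupport hx,
    image_eq_zero_of_notMem_tsupport fun h => hx (tsupport_fderiv_subset ℝ h)⟩

theorem IsCc1.continuous_gradient {U : Set (EuclideanSpace ℝ (Fin d))}
    {φ : EuclideanSpace ℝ (Fin d) → ℝ} (hφ : IsCc1 U φ) : Continuous (gradient φ) :=
  (InnerProductSpace.toDual ℝ _).symm.continuous.comp (hφ.1.continuous_fderiv one_ne_zero)

theorem IsCc1.integrableOn_mul_sq (hΩ : IsDomainSet Ω) {φ w : EuclideanSpace ℝ (Fin d) → ℝ}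
    (hφ : IsCc1 Ω φ) (hw : ContinuousOn w Ω) : IntegrableOn (fun x => w x * φ x ^ 2) Ω :=
  (hw.mul (hφ.1.continuous.pow 2).continuousOn).integrableOn_of_eqOn_zero_compl
    hΩ.1.measurableSet hφ.2.1 hφ.2.2 fun x hx => by simp [(IsCc1.eq_zero hx).1]

theorem IsCc1.integrableOn_mul_norm_fderiv_sq (hΩ : IsDomainSet Ω)
    {φ w : EuclideanSpace ℝ (Fin d) → ℝ} (hφ : IsCc1 Ω φ) (hw : ContinuousOn w Ω) :
    IntegrableOn (fun x => w x * ‖fderiv ℝ φ x‖ ^ 2) Ω :=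
  (hw.mul ((hφ.1.continuous_fderiv one_ne_zero).norm.pow 2).continuousOn
    ).integrableOn_of_eqOn_zero_compl
    hΩ.1.measurableSet hφ.2.1 hφ.2.2 fun x hx => by simp [(IsCc1.eq_zero hx).2]

theorem IsCc1.integrableOn_form (hΩ : IsDomainSet Ω) {φ : EuclideanSpace ℝ (Fin d) → ℝ}
    {C : EuclideanSpace ℝ (Fin d) → (EuclideanSpace ℝ (Fin d) →L[ℝ] EuclideanSpace ℝ (Fin d))}
    (hφ : IsCc1 Ω φ) (hC : ContinuousOn C Ω) :
    IntegrableOn (fun x => ⟪C x (gradient φ x), gradient φ x⟫) Ω := by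
  have hg := hφ.continuous_gradient.continuousOn (s := Ω)
  refine ((hC.clm_apply hg).inner hg).integrableOn_of_eqOn_zero_compl
    hΩ.1.measurableSet hφ.2.1 hφ.2.2 fun x hx => ?_
  simp [gradient, (IsCc1.eq_zero hx).2]

theorem L2N_eq {f : EuclideanSpace ℝ (Fin d) → ℝ} (hf : Integrable fun x => f x ^ 2) :
    L2N f = ENNReal.ofReal √(∫ x, f x ^ 2) := by
  rw [L2N, eLpNorm_eq_lintegral_rpow_enorm_toReal two_ne_zero ENNReal.ofNat_ne_top,
    Real.sqrt_eq_rpow, ← ENNReal.ofReal_rpow_of_nonneg (integral_nonneg fun x => sq_nonneg _)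
      (by norm_num), ofReal_integral_eq_lintegral_ofReal hf (.of_forall fun x => sq_nonneg _)]
  simp only [ENNReal.toReal_ofNat]
  congr 2
  ext x
  rw [← enorm_norm, Real.enorm_of_nonneg (norm_nonneg _), ENNReal.ofReal_rpow_of_nonneg
    (norm_nonneg _) (by norm_num)]
  congr 1
  norm_num

/-- The Hardy inequality for a single test function, in integral form. -/
theorem IsCc1.wNorm_le_iff (hΩ : IsDomainSet Ω) {ψ : EuclideanSpace ℝ (Fin d) → ℝ}
    (hψ : IsCc1 Ω ψ) (δ : ℝ) {a : ℝ} (ha : 0 ≤ a) :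
    wNorm Ω (δ / 2 - 1) ψ ≤ ENNReal.ofReal a * wGradNorm Ω (δ / 2) ψ ↔
      ∫ x in Ω, distB Ω x ^ (δ - 2) * ψ x ^ 2 ≤
        a ^ 2 * ∫ x in Ω, distB Ω x ^ δ * ‖fderiv ℝ ψ x‖ ^ 2 := by
  have hsq : ∀ (p : ℝ) x, (distB Ω x ^ p) ^ 2 = distB Ω x ^ (p * 2) := fun p x => by
    rw [← Real.rpow_natCast, ← Real.rpow_mul (distB_nonneg x)]; norm_num
  have h1 : ∀ x, (distB Ω x ^ (δ / 2 - 1) * ψ x) ^ 2 = distB Ω x ^ (δ - 2) * ψ x ^ 2 := fun x => by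
    rw [mul_pow, hsq, show (δ / 2 - 1) * 2 = δ - 2 by ring]
  have h2 : ∀ x, (distB Ω x ^ (δ / 2) * ‖fderiv ℝ ψ x‖) ^ 2 =
      distB Ω x ^ δ * ‖fderiv ℝ ψ x‖ ^ 2 := fun x => by
    rw [mul_pow, hsq, show δ / 2 * 2 = δ by ring]
  have z1 : ∀ x, x ∉ Ω → distB Ω x ^ (δ - 2) * ψ x ^ 2 = 0 := fun x hx => by
    simp [(IsCc1.eq_zero fun h => hx (hψ.2.2 h)).1]
  have z2 : ∀ x, x ∉ Ω → distB Ω x ^ δ * ‖fderiv ℝ ψ x‖ ^ 2 = 0 := fun x hx => by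
    simp [(IsCc1.eq_zero fun h => hx (hψ.2.2 h)).2]
  have i1 := (integrableOn_iff_integrable_of_support_subset (Function.support_subset_iff'.2 z1)).1
    (hψ.integrableOn_mul_sq hΩ (continuousOn_distB_rpow hΩ (δ - 2)))
  have i2 := (integrableOn_iff_integrable_of_support_subset (Function.support_subset_iff'.2 z2)).1
    (hψ.integrableOn_mul_norm_fderiv_sq hΩ (continuousOn_distB_rpow hΩ δ))
  rw [wNorm, wGradNorm, L2N_eq (by simpa only [h1] using i1), L2N_eq (by simpa only [h2] using i2),
    ← ENNReal.ofReal_mul ha, ENNReal.ofReal_le_ofReal_iff (by positivity)]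
  simp only [h1, h2]
  rw [setIntegral_eq_integral_of_forall_compl_eq_zero z1,
    setIntegral_eq_integral_of_forall_compl_eq_zero z2, Real.sqrt_le_left (by positivity), mul_pow,
    Real.sq_sqrt]
  exact integral_nonneg fun x => by rw [← h2]; positivity

/-- An approximation of `C¹` test functions by smooth ones. -/
theorem IsCc1.exists_seq_isCcInf (hΩ : IsOpen Ω) {φ : EuclideanSpace ℝ (Fin d) → ℝ}
    (hφ : IsCc1 Ω φ) :
    ∃ (F : ℕ → EuclideanSpace ℝ (Fin d) → ℝ) (K : Set (EuclideanSpace ℝ (Fin d))) (B : ℝ),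
      IsCompact K ∧ K ⊆ Ω ∧ (∀ n, IsCcInf Ω (F n)) ∧ (∀ n, tsupport (F n) ⊆ K) ∧
      (∀ n x, |F n x| ≤ B) ∧ (∀ n x, ‖fderiv ℝ (F n) x‖ ≤ B) ∧
      (∀ x, Filter.Tendsto (fun n => F n x) Filter.atTop (nhds (φ x))) ∧
      ∀ x, Filter.Tendsto (fun n => fderiv ℝ (F n) x) Filter.atTop (nhds (fderiv ℝ φ x)) := by
  obtain ⟨ρ, hρ, hρΩ⟩ := hφ.2.1.isCompact.exists_cthickening_subset_open hΩ hφ.2.2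
  have hK : IsCompact (cthickening ρ (tsupport φ)) := hφ.2.1.isCompact.cthickening
  have hdc := hφ.1.continuous_fderiv one_ne_zero
  have hε : ∀ n : ℕ, 0 < ρ / (n + 1) := fun n => by positivity
  have hε0 : Filter.Tendsto (fun n : ℕ => ρ / ((n : ℝ) + 1)) Filter.atTop (nhds 0) := by
    simpa [div_eq_mul_inv] using tendsto_one_div_add_atTop_nhds_zero_nat.const_mul ρ
  choose F hF hFv hFd using fun n : ℕ => hφ.1.exists_mollification hφ.2.1 (hε n)
  obtain ⟨B₁, hB₁⟩ := hφ.2.1.exists_bound_of_continuous hφ.1.continuous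
  obtain ⟨B₂, hB₂⟩ := (hφ.2.1.fderiv ℝ).exists_bound_of_continuous hdc
  have hts : ∀ n, tsupport (F n) ⊆ cthickening ρ (tsupport φ) := fun n => by
    refine closure_minimal (Function.support_subset_iff'.2 fun x hx => ?_) isClosed_cthickening
    have h := hFv n x 0 0 le_rfl fun y hy => by
      rw [dist_le_zero]
      refine image_eq_zero_of_notMem_tsupport fun hyt => hx ?_
      refine mem_cthickening_of_dist_le x y ρ _ hyt ?_
      rw [dist_comm]
      refine (mem_ball.1 hy).le.trans (div_le_self hρ.le ?_)
      simp
    exact dist_le_zero.1 h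
  refine ⟨F, _, max B₁ B₂, hK, hρΩ, fun n => ⟨hF n, hK.of_isClosed_subset (isClosed_tsupport _)
    (hts n), (hts n).trans hρΩ⟩, hts, fun n x => ?_, fun n x => ?_, fun x => ?_, fun x => ?_⟩
  · have hB : 0 ≤ B₁ := (norm_nonneg _).trans (hB₁ x)
    refine le_trans ?_ (le_max_left _ _)
    simpa using hFv n x 0 B₁ hB fun y _ => by simpa using hB₁ y
  · have hB : 0 ≤ B₂ := (norm_nonneg _).trans (hB₂ x)
    refine le_trans ?_ (le_max_right _ _)
    simpa using hFd n x 0 B₂ hB fun y _ => by simpa using hB₂ y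
  · refine Metric.tendsto_nhds.2 fun e he => ?_
    obtain ⟨η, hη, h⟩ := Metric.continuous_iff.1 hφ.1.continuous x (e / 2) (half_pos he)
    filter_upwards [hε0.eventually (gt_mem_nhds hη)] with n hn
    exact (hFv n x _ (e / 2) (half_pos he).le fun y hy =>
      (h y ((mem_ball.1 hy).trans hn)).le).trans_lt (half_lt_self he)
  · refine Metric.tendsto_nhds.2 fun e he => ?_
    obtain ⟨η, hη, h⟩ := Metric.continuous_iff.1 hdc x (e / 2) (half_pos he)
    filter_upwards [hε0.eventually (gt_mem_nhds hη)] with n hn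
    exact (hFd n x _ (e / 2) (half_pos he).le fun y hy =>
      (h y ((mem_ball.1 hy).trans hn)).le).trans_lt (half_lt_self he)

/-- A weighted form inequality for smooth test functions extends to `C¹` test functions. -/
theorem IsCc1.form_le_of_forall_isCcInf (hΩ : IsDomainSet Ω)
    {C : EuclideanSpace ℝ (Fin d) → (EuclideanSpace ℝ (Fin d) →L[ℝ] EuclideanSpace ℝ (Fin d))}
    (hC : ContinuousOn C Ω) {w : EuclideanSpace ℝ (Fin d) → ℝ} (hw : ContinuousOn w Ω) {β γ : ℝ}
    (h : ∀ φ, IsCcInf Ω φ → β * ∫ x in Ω, w x * φ x ^ 2 ≤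
      (∫ x in Ω, ⟪C x (gradient φ x), gradient φ x⟫) + γ * ∫ x in Ω, φ x ^ 2)
    {φ : EuclideanSpace ℝ (Fin d) → ℝ} (hφ : IsCc1 Ω φ) :
    β * ∫ x in Ω, w x * φ x ^ 2 ≤
      (∫ x in Ω, ⟪C x (gradient φ x), gradient φ x⟫) + γ * ∫ x in Ω, φ x ^ 2 := by
  obtain ⟨F, K, B, hK, hKΩ, hF, hFK, hB, hB', hlim, hlim'⟩ := hφ.exists_seq_isCcInf hΩ.1
  have hsq : ∀ v : EuclideanSpace ℝ (Fin d) → ℝ, ContinuousOn v Ω → Filter.Tendsto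
      (fun n => ∫ x in Ω, v x * F n x ^ 2) Filter.atTop (nhds (∫ x in Ω, v x * φ x ^ 2)) := by
    intro v hv
    refine tendsto_setIntegral_of_eqOn_zero_compl (w := fun x => |v x| * B ^ 2)
      (fun n => hv.mul ((hF n).1.continuous.pow 2).continuousOn)
      (hv.abs.mul continuousOn_const) hΩ.1.measurableSet hK hKΩ (fun n x hx => ?_)
      (fun n x _ => ?_) fun x => ((hlim x).pow 2).const_mul _
    · simp [(IsCc1.eq_zero fun h => hx (hFK n h)).1]
    · rw [abs_mul, abs_pow]
      gcongr
      exact hB n x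
  have hform : Filter.Tendsto (fun n => ∫ x in Ω, ⟪C x (gradient (F n) x), gradient (F n) x⟫)
      Filter.atTop (nhds (∫ x in Ω, ⟪C x (gradient φ x), gradient φ x⟫)) := by
    refine tendsto_setIntegral_of_eqOn_zero_compl (w := fun x => ‖C x‖ * B * B)
      (fun n => ?_) ((hC.norm.mul continuousOn_const).mul continuousOn_const)
      hΩ.1.measurableSet hK hKΩ (fun n x hx => ?_) (fun n x _ => ?_) fun x => ?_
    · have hg := (hF n).isCc1.continuous_gradient.continuousOn (s := Ω)
      exact (hC.clm_apply hg).inner hg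
    · simp [gradient, (IsCc1.eq_zero fun h => hx (hFK n h)).2]
    · have hg : ‖gradient (F n) x‖ ≤ B := (norm_gradient_eq _ _).trans_le (hB' n x)
      have hB0 : 0 ≤ B := (norm_nonneg _).trans hg
      refine (abs_real_inner_le_norm _ _).trans ?_
      gcongr
      exact (C x).le_of_opNorm_le_of_le le_rfl hg
    · have hg : Filter.Tendsto (fun n => gradient (F n) x) Filter.atTop (nhds (gradient φ x)) :=
        ((InnerProductSpace.toDual ℝ _).symm.continuous.tendsto _).comp (hlim' x)
      exact (((C x).continuous.tendsto _).comp hg).inner hg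
  have h1 := hsq (fun _ => 1) continuousOn_const
  simp only [one_mul] at h1
  exact le_of_tendsto_of_tendsto' ((hsq w hw).const_mul β) (hform.add (h1.const_mul γ))
    fun n => h _ (hF n)

theorem exists_one_lt_mul_pow_eq_one {q : ℝ} (hq : 0 < q) (hq1 : q < 1) {n : ℕ} (hn : n ≠ 0) :
    ∃ t : ℝ, 1 < t ∧ q * t ^ n = 1 := by
  refine ⟨q⁻¹ ^ (n : ℝ)⁻¹, Real.one_lt_rpow ((one_lt_inv₀ hq).2 hq1) (by positivity), ?_⟩
  rw [Real.rpow_inv_natCast_pow (by positivity) hn, mul_inv_cancel₀ hq.ne']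

theorem sq_add_le_mul_sq_add {t : ℝ} (ht : 1 < t) (a b : ℝ) :
    (a + b) ^ 2 ≤ t * a ^ 2 + t / (t - 1) * b ^ 2 := by
  have h : 0 < t - 1 := by linarith
  have key : t * a ^ 2 + t / (t - 1) * b ^ 2 - (a + b) ^ 2 =
      ((t - 1) * a - b) ^ 2 / (t - 1) := by
    field_simp
    ring
  have : 0 ≤ ((t - 1) * a - b) ^ 2 / (t - 1) := by positivity
  linarith

/-- Near the boundary the coefficients are comparable, up to a factor `t > 1`, with the scalar
coefficients `c d_Γ^δ`. -/
theorem exists_bdryLayer_form_bounds (hΩ : IsDomainSet Ω) {δ r₀ μ : ℝ}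
    {C : EuclideanSpace ℝ (Fin d) → (EuclideanSpace ℝ (Fin d) →L[ℝ] EuclideanSpace ℝ (Fin d))}
    {c : EuclideanSpace ℝ (Fin d) → ℝ} (hμ : 0 < μ) (hcμ : ∀ x ∈ bdryLayer Ω r₀, μ ≤ c x)
    (hbc : ∀ ε > (0 : ℝ), ∃ r ∈ Set.Ioc (0 : ℝ) r₀, ∀ x ∈ bdryLayer Ω r,
      ‖distB Ω x ^ (-δ) • C x
        - c x • ContinuousLinearMap.id ℝ (EuclideanSpace ℝ (Fin d))‖ ≤ ε)
    {t : ℝ} (ht : 1 < t) :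
    ∃ r ∈ Set.Ioc (0 : ℝ) r₀, ∀ x ∈ bdryLayer Ω r, ∀ v,
      c x * distB Ω x ^ δ * ‖v‖ ^ 2 ≤ t * ⟪C x v, v⟫ ∧
      ⟪C x v, v⟫ ≤ t * (c x * distB Ω x ^ δ * ‖v‖ ^ 2) := by
  have ht0 : 0 < t := by linarith
  have hti : 0 < 1 - t⁻¹ := sub_pos.2 (inv_lt_one_of_one_lt₀ ht)
  obtain ⟨r, hr, h⟩ := hbc (μ * (1 - t⁻¹)) (mul_pos hμ hti)
  refine ⟨r, hr, fun x hx v => ?_⟩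
  have hD := Real.rpow_pos_of_pos (distB_pos hΩ hx.1) δ
  have hc := hcμ x (bdryLayer_mono hr.2 hx)
  have h1 := abs_real_inner_le_norm ((distB Ω x ^ (-δ) • C x
        - c x • ContinuousLinearMap.id ℝ (EuclideanSpace ℝ (Fin d))) v) v
  have h2 : ‖(distB Ω x ^ (-δ) • C x
        - c x • ContinuousLinearMap.id ℝ (EuclideanSpace ℝ (Fin d))) v‖ * ‖v‖ ≤
        c x * (1 - t⁻¹) * ‖v‖ ^ 2 := by
    rw [sq, ← mul_assoc]
    refine mul_le_mul_of_nonneg_right ?_ (norm_nonneg _)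
    refine ContinuousLinearMap.le_of_opNorm_le _ ((h x hx).trans ?_) v
    exact mul_le_mul_of_nonneg_right hc hti.le
  have h3 := abs_le.1 (h1.trans h2)
  simp only [sub_apply, smul_apply,
    ContinuousLinearMap.id_apply, inner_sub_left, inner_smul_left, conj_trivial,
    real_inner_self_eq_norm_sq, Real.rpow_neg (distB_nonneg x)] at h3
  set D := distB Ω x ^ δ
  set Q := ⟪C x v, v⟫
  have hQ : Q = D * (D⁻¹ * Q) := by field_simp
  have hc0 : 0 < c x := hμ.trans_le hc
  set P := D⁻¹ * Q
  have hv := sq_nonneg ‖v‖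
  rw [hQ]
  have htt : t * t⁻¹ = 1 := mul_inv_cancel₀ ht0.ne'
  constructor
  · have h4 : c x * ‖v‖ ^ 2 ≤ t * P := by
      have := mul_le_mul_of_nonneg_left (show c x * t⁻¹ * ‖v‖ ^ 2 ≤ P by linarith [h3.1]) ht0.le
      linear_combination this - c x * ‖v‖ ^ 2 * htt
    linear_combination D * h4
  · have h5 : 2 - t⁻¹ ≤ t := by
      have : t + t⁻¹ - 2 = (t - 1) ^ 2 * t⁻¹ := by field_simp; ring
      nlinarith [mul_nonneg (sq_nonneg (t - 1)) (inv_pos.2 ht0).le]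
    have h4 : P ≤ t * (c x * ‖v‖ ^ 2) := by
      have := mul_le_mul_of_nonneg_right h5 (mul_nonneg hc0.le hv)
      linarith [h3.2]
    linear_combination D * h4

/-- The boundary Hardy inequality implies the form inequality, with control of the constant. -/
theorem BHardy.exists_form_le (hΩ : IsDomainSet Ω) {δ r₀ μ M : ℝ} (hδ : δ ∈ Set.Ico (0 : ℝ) 2)
    {C : EuclideanSpace ℝ (Fin d) → (EuclideanSpace ℝ (Fin d) →L[ℝ] EuclideanSpace ℝ (Fin d))}
    (hC : ContinuousOn C Ω) (hCnonneg : ∀ x ∈ Ω, ∀ v, 0 ≤ ⟪C x v, v⟫)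
    {c : EuclideanSpace ℝ (Fin d) → ℝ} {L : NNReal} (hc : LipschitzOnWith L c Ω)
    (hcM : ∀ x ∈ Ω, |c x| ≤ M) (hμ : 0 < μ) (hcμ : ∀ x ∈ bdryLayer Ω r₀, μ ≤ c x)
    (hbc : ∀ ε > (0 : ℝ), ∃ r ∈ Set.Ioc (0 : ℝ) r₀, ∀ x ∈ bdryLayer Ω r,
      ‖distB Ω x ^ (-δ) • C x
        - c x • ContinuousLinearMap.id ℝ (EuclideanSpace ℝ (Fin d))‖ ≤ ε)
    {r a β : ℝ} (hr : 0 < r) (ha : 0 < a) (hβ : 0 < β) (hβa : β * a ^ 2 < 1)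
    (h : BHardy Ω δ (bdryLayer Ω r) a) :
    ∃ γ ≥ (0 : ℝ), ∀ φ, IsCcInf Ω φ → β * ∫ x in Ω, c x * distB Ω x ^ (δ - 2) * φ x ^ 2 ≤
      (∫ x in Ω, ⟪C x (gradient φ x), gradient φ x⟫) + γ * ∫ x in Ω, φ x ^ 2 := by
  obtain ⟨t, ht, hqt⟩ := exists_one_lt_mul_pow_eq_one (by positivity) hβa (n := 4) (by norm_num)
  have ht0 : 0 < t := by linarith
  have ht1 : 0 < t - 1 := by linarith
  obtain ⟨r₁, hr₁, hQ⟩ := exists_bdryLayer_form_bounds hΩ hμ hcμ hbc ht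
  obtain ⟨u, hu, ⟨Ku, hKu⟩, ⟨B, hB⟩, ⟨m, hm, hmu⟩, huc⟩ :=
    (hc.mono (bdryLayer_subset r₀)).exists_smooth_sqrt hμ
      (fun x hx => ⟨hcμ x hx, (le_abs_self _).trans (hcM x hx.1)⟩) ht
  set s : ℝ := min r r₁ / 4 with hs
  have hs0 : 0 < s := by have := lt_min hr hr₁.1; positivity
  have hsr : 3 * s < r := by linarith [min_le_left r r₁]
  have hsr₁ : 3 * s < r₁ := by linarith [min_le_right r r₁]
  obtain ⟨χ, hχ, ⟨Kχ, hKχ⟩, hχ01, hχ1, hχ0⟩ :=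
    (lipschitzWith_distB (Ω := Ω)).exists_smooth_cutoff hs0
  have hM0 : 0 ≤ M := by
    obtain ⟨x, hx⟩ := hΩ.2.1.nonempty
    exact (abs_nonneg _).trans (hcM x hx)
  set K : ℝ := B * Kχ + Ku with hK
  set κ : ℝ := r₁ ^ δ * (t / (t - 1) * K ^ 2) with hκ
  have hr₁δ : 0 < r₁ ^ δ := Real.rpow_pos_of_pos hr₁.1 _
  have hκ0 : 0 ≤ κ := by positivity
  have hsδ : 0 < s ^ (δ - 2) := Real.rpow_pos_of_pos hs0 _
  refine ⟨β * (t * a ^ 2 * κ + M * s ^ (δ - 2)), by positivity, fun φ hφ => ?_⟩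
  have hφ1 := hφ.isCc1
  set v : EuclideanSpace ℝ (Fin d) → ℝ := fun x => u x * χ x with hv
  have hvd : ContDiff ℝ 1 v := (hu.mul hχ).of_le (by exact_mod_cast le_top)
  have hvK : ∀ x, ‖fderiv ℝ v x‖ ≤ K := fun x => by
    rw [hv, fderiv_fun_mul ((hu.differentiable (by simp)) x) ((hχ.differentiable (by simp)) x)]
    refine (norm_add_le _ _).trans ?_
    rw [norm_smul, norm_smul, Real.norm_of_nonneg (hm.le.trans (hmu x)),
      Real.norm_of_nonneg (hχ01 x).1, hK]
    have h1 := mul_le_mul (hB x) (hKχ x) (norm_nonneg _) ((hm.le.trans (hmu x)).trans (hB x))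
    have h2 := mul_le_mul (hχ01 x).2 (hKu x) (norm_nonneg _) zero_le_one
    linarith
  set ψ : EuclideanSpace ℝ (Fin d) → ℝ := fun x => v x * φ x with hψ
  have hψφ : tsupport ψ ⊆ tsupport φ := tsupport_mul_subset_right
  have hψχ : ∀ x ∈ tsupport ψ, distB Ω x ≤ 3 * s := fun x hx => by
    refine closure_minimal (Function.support_subset_iff'.2 fun y hy => ?_)
      (isClosed_le lipschitzWith_distB.continuous continuous_const) hx
    simp [hψ, hv, hχ0 y (not_le.1 hy).le]
  have hψc : IsCc1 Ω ψ := ⟨hvd.mul hφ1.1, hφ.2.1.of_isClosed_subset (isClosed_tsupport _) hψφ,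
    hψφ.trans hφ.2.2⟩
  have hψr : IsCc1 (bdryLayer Ω r) ψ :=
    ⟨hψc.1, hψc.2.1, fun x hx => ⟨hψc.2.2 hx, (hψχ x hx).trans_lt hsr⟩⟩
  have hIJ := (hψc.wNorm_le_iff hΩ δ ha.le).1 (h ψ hψr)
  have hD := continuousOn_distB_rpow hΩ
  have iN : IntegrableOn (fun x => φ x ^ 2) Ω := by
    simpa using hφ1.integrableOn_mul_sq hΩ (w := fun _ => 1) continuousOn_const
  have iA := hφ1.integrableOn_mul_sq hΩ (hc.continuousOn.mul (hD (δ - 2)))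
  have iI := hψc.integrableOn_mul_sq hΩ (hD (δ - 2))
  have iJ := hψc.integrableOn_mul_norm_fderiv_sq hΩ (hD δ)
  have iH := hφ1.integrableOn_form hΩ hC
  have hmeas := hΩ.1.measurableSet
  have hAI : ∫ x in Ω, c x * distB Ω x ^ (δ - 2) * φ x ^ 2 ≤
      t * (∫ x in Ω, distB Ω x ^ (δ - 2) * ψ x ^ 2) + M * s ^ (δ - 2) * ∫ x in Ω, φ x ^ 2 := by
    rw [← integral_const_mul, ← integral_const_mul,
      ← integral_add (iI.const_mul _) (iN.const_mul _)]
    refine setIntegral_mono_on iA ((iI.const_mul _).add (iN.const_mul _)) hmeas fun x hx => ?_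
    have hx0 := distB_pos hΩ hx
    have hDx : 0 < distB Ω x ^ (δ - 2) := Real.rpow_pos_of_pos hx0 _
    have hφx := sq_nonneg (φ x)
    rcases le_or_gt (distB Ω x) s with hxs | hxs
    · have hxr : x ∈ bdryLayer Ω r₀ := ⟨hx, by linarith [hr₁.2]⟩
      have h1 : c x * (distB Ω x ^ (δ - 2) * φ x ^ 2) ≤
          t * u x ^ 2 * (distB Ω x ^ (δ - 2) * φ x ^ 2) :=
        mul_le_mul_of_nonneg_right (huc x hxr).1 (by positivity)
      have h2 : 0 ≤ M * s ^ (δ - 2) * φ x ^ 2 := by positivity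
      simp only [hψ, hv, hχ1 x hxs]
      linarith
    · have h1 : distB Ω x ^ (δ - 2) ≤ s ^ (δ - 2) :=
        Real.rpow_le_rpow_of_nonpos hs0 hxs.le (by linarith [hδ.2])
      have h2 : c x * distB Ω x ^ (δ - 2) ≤ M * s ^ (δ - 2) :=
        mul_le_mul ((le_abs_self _).trans (hcM x hx)) h1 hDx.le hM0
      have h3 := mul_le_mul_of_nonneg_right h2 hφx
      have h4 : 0 ≤ t * (distB Ω x ^ (δ - 2) * ψ x ^ 2) := by positivity
      linarith
  have hJH : ∫ x in Ω, distB Ω x ^ δ * ‖fderiv ℝ ψ x‖ ^ 2 ≤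
      t ^ 3 * (∫ x in Ω, ⟪C x (gradient φ x), gradient φ x⟫) + κ * ∫ x in Ω, φ x ^ 2 := by
    rw [← integral_const_mul, ← integral_const_mul,
      ← integral_add (iH.const_mul _) (iN.const_mul _)]
    refine setIntegral_mono_on iJ ((iH.const_mul _).add (iN.const_mul _)) hmeas fun x hx => ?_
    have hCx := hCnonneg x hx (gradient φ x)
    by_cases hxψ : x ∈ tsupport ψ
    · have hxr : x ∈ bdryLayer Ω r₁ := ⟨hx, (hψχ x hxψ).trans_lt hsr₁⟩
      have hDr : distB Ω x ^ δ ≤ r₁ ^ δ := Real.rpow_le_rpow (distB_nonneg x) hxr.2.le hδ.1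
      have hD0 : 0 ≤ distB Ω x ^ δ := Real.rpow_nonneg (distB_nonneg x) _
      have hg : ‖fderiv ℝ ψ x‖ ^ 2 ≤
          t * (v x * ‖fderiv ℝ φ x‖) ^ 2 + t / (t - 1) * (|φ x| * K) ^ 2 := by
        refine le_trans ?_ (sq_add_le_mul_sq_add ht _ _)
        refine pow_le_pow_left₀ (norm_nonneg _) ?_ 2
        rw [hψ, fderiv_fun_mul (hvd.differentiable one_ne_zero x)
          (hφ1.1.differentiable one_ne_zero x)]
        refine (norm_add_le _ _).trans ?_
        rw [norm_smul, norm_smul, Real.norm_eq_abs (φ x),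
          Real.norm_of_nonneg (mul_nonneg (hm.le.trans (hmu x)) (hχ01 x).1)]
        exact add_le_add le_rfl (mul_le_mul_of_nonneg_left (hvK x) (abs_nonneg _))
      have hv2 : v x ^ 2 ≤ t * c x := by
        refine le_trans ?_ (huc x (bdryLayer_mono hr₁.2 hxr)).2
        refine pow_le_pow_left₀ (mul_nonneg (hm.le.trans (hmu x)) (hχ01 x).1) ?_ 2
        exact mul_le_of_le_one_right (hm.le.trans (hmu x)) (hχ01 x).2
      have hq := (hQ x hxr (gradient φ x)).1
      rw [norm_gradient_eq] at hq
      rw [mul_pow (v x), mul_pow |φ x|, sq_abs] at hg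
      calc distB Ω x ^ δ * ‖fderiv ℝ ψ x‖ ^ 2
          ≤ distB Ω x ^ δ * (t * (t * c x * ‖fderiv ℝ φ x‖ ^ 2)) +
            r₁ ^ δ * (t / (t - 1) * (φ x ^ 2 * K ^ 2)) := by
            refine (mul_le_mul_of_nonneg_left hg hD0).trans ?_
            rw [mul_add]
            gcongr
        _ = t ^ 2 * (c x * distB Ω x ^ δ * ‖fderiv ℝ φ x‖ ^ 2) + κ * φ x ^ 2 := by
            rw [hκ]; ring
        _ ≤ t ^ 2 * (t * ⟪C x (gradient φ x), gradient φ x⟫) + κ * φ x ^ 2 := by gcongr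
        _ = _ := by ring
    · rw [(IsCc1.eq_zero hxψ).2]
      simp only [norm_zero, ne_eq, OfNat.ofNat_ne_zero, not_false_eq_true, zero_pow, mul_zero]
      positivity
  set H := ∫ x in Ω, ⟪C x (gradient φ x), gradient φ x⟫
  set N := ∫ x in Ω, φ x ^ 2
  have h1 := mul_le_mul_of_nonneg_left hAI hβ.le
  have h2 := mul_le_mul_of_nonneg_left hIJ (mul_nonneg hβ.le ht0.le)
  have h3 := mul_le_mul_of_nonneg_left hJH (by positivity : 0 ≤ β * t * a ^ 2)
  linear_combination h1 + h2 + h3 + H * hqt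

/-- The form inequality implies the boundary Hardy inequality, with control of the constant. -/
theorem exists_bHardy_of_form_le (hΩ : IsDomainSet Ω) {δ r₀ μ M : ℝ}
    (hδ : δ ∈ Set.Ico (0 : ℝ) 2)
    {C : EuclideanSpace ℝ (Fin d) → (EuclideanSpace ℝ (Fin d) →L[ℝ] EuclideanSpace ℝ (Fin d))}
    (hC : ContinuousOn C Ω)
    {c : EuclideanSpace ℝ (Fin d) → ℝ} {L : NNReal} (hc : LipschitzOnWith L c Ω)
    (hcM : ∀ x ∈ Ω, |c x| ≤ M) (hμ : 0 < μ) (hcμ : ∀ x ∈ bdryLayer Ω r₀, μ ≤ c x)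
    (hbc : ∀ ε > (0 : ℝ), ∃ r ∈ Set.Ioc (0 : ℝ) r₀, ∀ x ∈ bdryLayer Ω r,
      ‖distB Ω x ^ (-δ) • C x
        - c x • ContinuousLinearMap.id ℝ (EuclideanSpace ℝ (Fin d))‖ ≤ ε)
    {a β γ : ℝ} (ha : 0 < a) (hβ : 0 < β) (hβa : 1 < β * a ^ 2) (hγ : 0 ≤ γ)
    (h : ∀ φ, IsCcInf Ω φ → β * ∫ x in Ω, c x * distB Ω x ^ (δ - 2) * φ x ^ 2 ≤
      (∫ x in Ω, ⟪C x (gradient φ x), gradient φ x⟫) + γ * ∫ x in Ω, φ x ^ 2) :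
    ∃ r > (0 : ℝ), BHardy Ω δ (bdryLayer Ω r) a := by
  obtain ⟨t, ht, hqt⟩ := exists_one_lt_mul_pow_eq_one (inv_pos.2 (by positivity : 0 < β * a ^ 2))
    (inv_lt_one_of_one_lt₀ hβa) (n := 5) (by norm_num)
  rw [inv_mul_eq_one₀ (by positivity)] at hqt
  have ht0 : 0 < t := by linarith
  have ht1 : 0 < t - 1 := by linarith
  obtain ⟨r₁, hr₁, hQ⟩ := exists_bdryLayer_form_bounds hΩ hμ hcμ hbc ht
  obtain ⟨u, hu, ⟨K, hK⟩, -, ⟨m, hm, hmu⟩, huc⟩ :=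
    (hc.mono (bdryLayer_subset r₀)).exists_smooth_sqrt hμ
      (fun x hx => ⟨hcμ x hx, (le_abs_self _).trans (hcM x hx.1)⟩) ht
  set κ : ℝ → ℝ := fun r =>
    t ^ 2 * (t / (t - 1) * K ^ 2) / m ^ 2 * r ^ 2 + γ / m ^ 2 * r ^ (2 - δ) with hκ
  have hδ2 : 0 < 2 - δ := by linarith [hδ.2]
  have hκc : ContinuousAt (fun r => t * κ r) 0 := by
    have := Real.continuousAt_rpow_const 0 (2 - δ) (Or.inr hδ2.le)
    fun_prop
  have hκ0 : t * κ 0 < β - β / t := by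
    rw [hκ]
    simp only
    rw [Real.zero_rpow hδ2.ne']
    have : β / t < β := div_lt_self hβ ht
    simpa using this
  obtain ⟨r, hr⟩ := (((hκc.eventually_lt continuousAt_const hκ0).filter_mono
    nhdsWithin_le_nhds).and (Ioc_mem_nhdsGT hr₁.1)).exists
  obtain ⟨hκr, hr0, hrr₁⟩ := hr
  refine ⟨r, hr0, fun ψ hψr => ?_⟩
  have hψ := hψr.mono (bdryLayer_subset r)
  rw [hψ.wNorm_le_iff hΩ δ ha.le]
  have hu0 : ∀ x, 0 < u x := fun x => hm.trans_le (hmu x)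
  set φ : EuclideanSpace ℝ (Fin d) → ℝ := fun x => (u x)⁻¹ * ψ x with hφ
  have hφψ : tsupport φ ⊆ tsupport ψ := tsupport_mul_subset_right
  have hu1 : ContDiff ℝ 1 u := hu.of_le (by exact_mod_cast le_top)
  have hφc : IsCc1 Ω φ := ⟨(hu1.inv fun x => (hu0 x).ne').mul hψ.1,
    hψ.2.1.of_isClosed_subset (isClosed_tsupport _) hφψ, hφψ.trans hψ.2.2⟩
  have hψφ : ψ = fun x => u x * φ x := by
    ext x
    rw [hφ]
    field_simp [(hu0 x).ne']
  have hD := continuousOn_distB_rpow hΩ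
  have iN : IntegrableOn (fun x => φ x ^ 2) Ω := by
    simpa using hφc.integrableOn_mul_sq hΩ (w := fun _ => 1) continuousOn_const
  have iA := hφc.integrableOn_mul_sq hΩ (hc.continuousOn.mul (hD (δ - 2)))
  have iI := hψ.integrableOn_mul_sq hΩ (hD (δ - 2))
  have iJ := hψ.integrableOn_mul_norm_fderiv_sq hΩ (hD δ)
  have iH := hφc.integrableOn_form hΩ hC
  have hmeas := hΩ.1.measurableSet
  have hII := hφc.form_le_of_forall_isCcInf hΩ hC (hc.continuousOn.mul (hD (δ - 2))) h
  have hIA : ∫ x in Ω, distB Ω x ^ (δ - 2) * ψ x ^ 2 ≤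
      t * ∫ x in Ω, c x * distB Ω x ^ (δ - 2) * φ x ^ 2 := by
    rw [← integral_const_mul]
    refine setIntegral_mono_on iI (iA.const_mul _) hmeas fun x hx => ?_
    by_cases hxψ : x ∈ tsupport ψ
    · have hxr := bdryLayer_mono (hrr₁.trans hr₁.2) (hψr.2.2 hxψ)
      have hD0 : 0 ≤ distB Ω x ^ (δ - 2) := Real.rpow_nonneg (distB_nonneg x) _
      have := mul_le_mul_of_nonneg_right (huc x hxr).2 (mul_nonneg hD0 (sq_nonneg (φ x)))
      rw [hψφ]
      linear_combination this
    · rw [(IsCc1.eq_zero hxψ).1, (IsCc1.eq_zero fun h => hxψ (hφψ h)).1]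
      simp
  have hHJ : (∫ x in Ω, ⟪C x (gradient φ x), gradient φ x⟫) + γ * ∫ x in Ω, φ x ^ 2 ≤
      t ^ 3 * (∫ x in Ω, distB Ω x ^ δ * ‖fderiv ℝ ψ x‖ ^ 2) +
        κ r * ∫ x in Ω, distB Ω x ^ (δ - 2) * ψ x ^ 2 := by
    rw [← integral_const_mul, ← integral_const_mul, ← integral_const_mul,
      ← integral_add iH (iN.const_mul _), ← integral_add (iJ.const_mul _) (iI.const_mul _)]
    refine setIntegral_mono_on (iH.add (iN.const_mul _)) ((iJ.const_mul _).add (iI.const_mul _))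
      hmeas fun x hx => ?_
    by_cases hxψ : x ∈ tsupport ψ
    · have hxr := hψr.2.2 hxψ
      have hxr₁ := bdryLayer_mono hrr₁ hxr
      have hx0 := distB_pos hΩ hx
      have hE0 : 0 < distB Ω x ^ (δ - 2) := Real.rpow_pos_of_pos hx0 _
      have hD0 : 0 < distB Ω x ^ δ := Real.rpow_pos_of_pos hx0 _
      have hq := (hQ x hxr₁ (gradient φ x)).2
      rw [norm_gradient_eq] at hq
      have hg : (u x * ‖fderiv ℝ φ x‖) ^ 2 ≤
          t * ‖fderiv ℝ ψ x‖ ^ 2 + t / (t - 1) * (|φ x| * K) ^ 2 := by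
        refine le_trans ?_ (sq_add_le_mul_sq_add ht _ _)
        refine pow_le_pow_left₀ (mul_nonneg (hu0 x).le (norm_nonneg _)) ?_ 2
        have hd : u x • fderiv ℝ φ x = fderiv ℝ ψ x - φ x • fderiv ℝ u x := by
          rw [hψφ, fderiv_fun_mul (hu1.differentiable one_ne_zero x)
            (hφc.1.differentiable one_ne_zero x), add_sub_cancel_right]
        rw [← Real.norm_of_nonneg (hu0 x).le, ← norm_smul, hd]
        refine (norm_sub_le _ _).trans ?_
        rw [norm_smul, Real.norm_eq_abs]
        exact add_le_add le_rfl (mul_le_mul_of_nonneg_left (hK x) (abs_nonneg _))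
      have hφ2 : φ x ^ 2 ≤ ψ x ^ 2 / m ^ 2 := by
        rw [le_div_iff₀ (by positivity), congrFun hψφ x, mul_pow (u x), mul_comm]
        exact mul_le_mul_of_nonneg_right (pow_le_pow_left₀ hm.le (hmu x) 2) (sq_nonneg _)
      have hDE : distB Ω x ^ δ ≤ r ^ 2 * distB Ω x ^ (δ - 2) := by
        have : distB Ω x ^ δ = distB Ω x ^ 2 * distB Ω x ^ (δ - 2) := by
          rw [← Real.rpow_natCast, ← Real.rpow_add hx0]; norm_num
        rw [this]
        exact mul_le_mul_of_nonneg_right (pow_le_pow_left₀ hx0.le hxr.2.le 2) hE0.le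
      have hE1 : 1 ≤ r ^ (2 - δ) * distB Ω x ^ (δ - 2) := by
        have : 1 = distB Ω x ^ (2 - δ) * distB Ω x ^ (δ - 2) := by
          rw [← Real.rpow_add hx0]; norm_num
        rw [this]
        exact mul_le_mul_of_nonneg_right (Real.rpow_le_rpow hx0.le hxr.2.le hδ2.le) hE0.le
      have hcu := (huc x (bdryLayer_mono hr₁.2 hxr₁)).1
      rw [mul_pow (u x), mul_pow |φ x|, sq_abs] at hg
      set T := t / (t - 1)
      have hT : 0 < T := by positivity
      have e1 : ⟪C x (gradient φ x), gradient φ x⟫ ≤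
          t ^ 3 * (distB Ω x ^ δ * ‖fderiv ℝ ψ x‖ ^ 2) +
            t ^ 2 * (T * K ^ 2) / m ^ 2 * r ^ 2 * (distB Ω x ^ (δ - 2) * ψ x ^ 2) := by
        calc ⟪C x (gradient φ x), gradient φ x⟫
            ≤ t * (t * u x ^ 2 * distB Ω x ^ δ * ‖fderiv ℝ φ x‖ ^ 2) := hq.trans (by gcongr)
          _ = t ^ 2 * distB Ω x ^ δ * (u x ^ 2 * ‖fderiv ℝ φ x‖ ^ 2) := by ring
          _ ≤ t ^ 2 * distB Ω x ^ δ * (t * ‖fderiv ℝ ψ x‖ ^ 2 + T * (φ x ^ 2 * K ^ 2)) := by gcongr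
          _ = t ^ 3 * (distB Ω x ^ δ * ‖fderiv ℝ ψ x‖ ^ 2) +
              t ^ 2 * (T * K ^ 2) * (distB Ω x ^ δ * φ x ^ 2) := by ring
          _ ≤ t ^ 3 * (distB Ω x ^ δ * ‖fderiv ℝ ψ x‖ ^ 2) +
              t ^ 2 * (T * K ^ 2) * (r ^ 2 * distB Ω x ^ (δ - 2) * (ψ x ^ 2 / m ^ 2)) := by
              gcongr
          _ = _ := by ring
      have e2 : γ * φ x ^ 2 ≤ γ / m ^ 2 * r ^ (2 - δ) * (distB Ω x ^ (δ - 2) * ψ x ^ 2) := by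
        calc γ * φ x ^ 2 ≤ γ * (ψ x ^ 2 / m ^ 2) * 1 := by rw [mul_one]; gcongr
          _ ≤ γ * (ψ x ^ 2 / m ^ 2) * (r ^ (2 - δ) * distB Ω x ^ (δ - 2)) := by gcongr
          _ = _ := by ring
      simp only [hκ]
      linear_combination e1 + e2
    · have h0 := IsCc1.eq_zero fun h => hxψ (hφψ h)
      simp [(IsCc1.eq_zero hxψ).1, (IsCc1.eq_zero hxψ).2, h0.1, h0.2, gradient]
  set I := ∫ x in Ω, distB Ω x ^ (δ - 2) * ψ x ^ 2
  set J := ∫ x in Ω, distB Ω x ^ δ * ‖fderiv ℝ ψ x‖ ^ 2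
  have hI0 : 0 ≤ I := setIntegral_nonneg hmeas fun x _ =>
    mul_nonneg (Real.rpow_nonneg (distB_nonneg x) _) (sq_nonneg _)
  have h1 : β * I ≤ t ^ 4 * J + t * κ r * I := by
    have h2 := mul_le_mul_of_nonneg_left hIA hβ.le
    have h3 := mul_le_mul_of_nonneg_left (hII.trans hHJ) ht0.le
    linear_combination h2 + h3
  have h2 := mul_le_mul_of_nonneg_right hκr.le hI0
  have h3 : β / t * I ≤ t ^ 4 * J := by linarith
  have h4 : β * I ≤ t ^ 5 * J := by
    have h5 := mul_le_mul_of_nonneg_left h3 ht0.le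
    have h6 : t * (β / t * I) = β * I := by field_simp
    linear_combination h5 - h6
  rw [← hqt, mul_assoc] at h4
  exact le_of_mul_le_mul_left h4 hβ

theorem hardyConst_le {δ r a : ℝ} (hr : 0 < r) (ha : 0 < a) (h : BHardy Ω δ (bdryLayer Ω r) a) :
    hardyConst Ω δ ≤ ENNReal.ofReal a :=
  (iInf₂_le r hr).trans (sInf_le ⟨a, ha, rfl, h⟩)

theorem exists_bHardy_of_hardyConst_lt {δ b : ℝ} (h : hardyConst Ω δ < ENNReal.ofReal b) :
    ∃ r > 0, ∃ a > 0, a < b ∧ BHardy Ω δ (bdryLayer Ω r) a := by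
  obtain ⟨r, hr⟩ := iInf_lt_iff.1 h
  obtain ⟨hr0, hr⟩ := iInf_lt_iff.1 hr
  obtain ⟨_, ⟨a, ha, rfl, hB⟩, hab⟩ := sInf_lt_iff.1 hr
  exact ⟨r, hr0, a, ha, (ENNReal.ofReal_lt_ofReal_iff_of_nonneg ha.le).1 hab, hB⟩

end Hardy

/-- Let `δ ∈ [0,2)`, `r₀ > 0`, `C` a Lipschitz, symmetric,
positive-definite (operator-valued) coefficient on `Ω` and `c` a bounded Lipschitz
profile with `c ≥ μ > 0` near the boundary, satisfying the boundary condition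
`inf_{r ∈ (0,r₀]} sup_{x ∈ Γ_r} ‖C(x) d_Γ(x)^{-δ} - c(x) I‖ = 0`. With the quadratic
form `h(φ) = ∫_Ω ⟨C ∇φ, ∇φ⟩`, the boundary Hardy inequality (I) holds on some layer
`Γ_r` iff (II) there are `β > 0`, `γ ≥ 0` with
`β ∫_Ω c d_Γ^{δ-2} φ² ≤ h(φ) + γ‖φ‖₂²` for all `φ ∈ C_c^∞(Ω)`; and in that case the
supremum of the admissible `β` equals `a_δ(Γ)^{-2}`. -/
theorem stmt19 {d : ℕ} (hd : 1 ≤ d) (Ω : Set (EuclideanSpace ℝ (Fin d)))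
    (hΩ : IsDomainSet Ω)
    (δ : ℝ) (hδ : δ ∈ Set.Ico (0:ℝ) 2) (r₀ : ℝ) (hr₀ : 0 < r₀)
    (C : EuclideanSpace ℝ (Fin d) →
      (EuclideanSpace ℝ (Fin d) →L[ℝ] EuclideanSpace ℝ (Fin d)))
    (hClip : ∃ L : NNReal, LipschitzOnWith L C Ω)
    (hCsymm : ∀ x ∈ Ω, ∀ v w : EuclideanSpace ℝ (Fin d), ⟪C x v, w⟫ = ⟪v, C x w⟫)
    (hCpos : ∀ x ∈ Ω, ∀ v : EuclideanSpace ℝ (Fin d), v ≠ 0 → 0 < ⟪C x v, v⟫)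
    (c : EuclideanSpace ℝ (Fin d) → ℝ) (μ : ℝ) (hμ : 0 < μ)
    (hclip : ∃ L : NNReal, LipschitzOnWith L c Ω)
    (hcbdd : ∃ M : ℝ, ∀ x ∈ Ω, |c x| ≤ M)
    (hcμ : ∀ x ∈ bdryLayer Ω r₀, μ ≤ c x)
    (hbc : ∀ ε > (0:ℝ), ∃ r ∈ Set.Ioc (0:ℝ) r₀, ∀ x ∈ bdryLayer Ω r,
      ‖distB Ω x ^ (-δ) • C x
        - c x • ContinuousLinearMap.id ℝ (EuclideanSpace ℝ (Fin d))‖ ≤ ε) :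
    ((∃ r > (0:ℝ), ∃ a > (0:ℝ), BHardy Ω δ (bdryLayer Ω r) a) ↔
      (∃ β > (0:ℝ), ∃ γ ≥ (0:ℝ), ∀ φ : EuclideanSpace ℝ (Fin d) → ℝ, IsCcInf Ω φ →
        β * ∫ x in Ω, c x * distB Ω x ^ (δ-2) * (φ x)^2
          ≤ (∫ x in Ω, ⟪C x (gradient φ x), gradient φ x⟫) + γ * ∫ x in Ω, (φ x)^2)) ∧
    ((∃ r > (0:ℝ), ∃ a > (0:ℝ), BHardy Ω δ (bdryLayer Ω r) a) →
      sSup {β : ℝ | 0 < β ∧ ∃ γ ≥ (0:ℝ), ∀ φ : EuclideanSpace ℝ (Fin d) → ℝ,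
          IsCcInf Ω φ →
          β * ∫ x in Ω, c x * distB Ω x ^ (δ-2) * (φ x)^2
            ≤ (∫ x in Ω, ⟪C x (gradient φ x), gradient φ x⟫) + γ * ∫ x in Ω, (φ x)^2}
        = ((hardyConst Ω δ).toReal)⁻¹ ^ 2) := by
  obtain ⟨L, hC⟩ := hClip
  obtain ⟨L', hc⟩ := hclip
  obtain ⟨M, hcM⟩ := hcbdd
  have hCnonneg : ∀ x ∈ Ω, ∀ v, 0 ≤ ⟪C x v, v⟫ := fun x hx v => by
    rcases eq_or_ne v 0 with rfl | hv
    · simp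
    · exact (hCpos x hx v hv).le
  set A : ℝ := (hardyConst Ω δ).toReal with hA
  have hA0 : 0 ≤ A := ENNReal.toReal_nonneg
  have key : ∀ β > (0 : ℝ), ∀ γ ≥ (0 : ℝ), (∀ φ : EuclideanSpace ℝ (Fin d) → ℝ, IsCcInf Ω φ →
      β * ∫ x in Ω, c x * distB Ω x ^ (δ-2) * (φ x)^2
        ≤ (∫ x in Ω, ⟪C x (gradient φ x), gradient φ x⟫) + γ * ∫ x in Ω, (φ x)^2) →
      ∀ a > (0 : ℝ), 1 < β * a ^ 2 → ∃ r > (0 : ℝ), BHardy Ω δ (bdryLayer Ω r) a :=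
    fun β hβ γ hγ h a ha hβa =>
      exists_bHardy_of_form_le hΩ hδ hC.continuousOn hc hcM hμ hcμ hbc ha hβ hβa hγ h
  refine ⟨⟨?_, ?_⟩, ?_⟩
  · rintro ⟨r, hr, a, ha, h⟩
    refine ⟨(a ^ 2)⁻¹ / 2, by positivity, h.exists_form_le hΩ hδ hC.continuousOn hCnonneg hc hcM hμ
      hcμ hbc hr ha (by positivity) ?_⟩
    rw [div_mul_eq_mul_div, inv_mul_cancel₀ (by positivity)]
    norm_num
  · rintro ⟨β, hβ, γ, hγ, h⟩
    obtain ⟨r, hr, hB⟩ := key β hβ γ hγ h (√(2 / β)) (by positivity) (by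
      rw [Real.sq_sqrt (by positivity), mul_div_cancel₀ _ hβ.ne']
      norm_num)
    exact ⟨r, hr, _, by positivity, hB⟩
  · rintro ⟨r, hr, a, ha, hB⟩
    have hfin : hardyConst Ω δ ≠ ⊤ :=
      ((hardyConst_le hr ha hB).trans_lt ENNReal.ofReal_lt_top).ne
    set S := {β : ℝ | 0 < β ∧ ∃ γ ≥ (0:ℝ), ∀ φ : EuclideanSpace ℝ (Fin d) → ℝ,
          IsCcInf Ω φ →
          β * ∫ x in Ω, c x * distB Ω x ^ (δ-2) * (φ x)^2
            ≤ (∫ x in Ω, ⟪C x (gradient φ x), gradient φ x⟫) + γ * ∫ x in Ω, (φ x)^2} with hS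
    have hmem : ∀ β > 0, β * A ^ 2 < 1 → β ∈ S := fun β hβ hβA => by
      have hAb : A < √β⁻¹ := by
        rw [Real.lt_sqrt hA0, ← one_div, lt_div_iff₀' hβ]
        exact hβA
      obtain ⟨r, hr, a, ha, hab, hB⟩ := exists_bHardy_of_hardyConst_lt
        ((ENNReal.lt_ofReal_iff_toReal_lt hfin).2 hAb)
      refine ⟨hβ, hB.exists_form_le hΩ hδ hC.continuousOn hCnonneg hc hcM hμ hcμ hbc hr ha hβ ?_⟩
      rwa [Real.lt_sqrt ha.le, ← one_div, lt_div_iff₀' hβ] at hab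
    have hle : ∀ β ∈ S, β * A ^ 2 ≤ 1 := fun β ⟨hβ, γ, hγ, h⟩ => by
      by_contra! hlt
      have hAb : √β⁻¹ < A := by
        rw [Real.sqrt_lt' (lt_of_le_of_ne hA0 fun h0 => by
          rw [← h0] at hlt; norm_num at hlt), ← one_div, div_lt_iff₀' hβ]
        exact hlt
      obtain ⟨b, hb, hbA⟩ := exists_between hAb
      have hb0 : 0 < b := (Real.sqrt_nonneg _).trans_lt hb
      obtain ⟨r, hr, hB⟩ := key β hβ γ hγ h b hb0 (by
        rwa [Real.sqrt_lt' hb0, ← one_div, div_lt_iff₀' hβ] at hb)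
      exact hbA.not_ge (ENNReal.toReal_le_of_le_ofReal hb0.le (hardyConst_le hr hb0 hB))
    rcases hA0.eq_or_lt with h0 | h0
    · rw [← h0, _root_.inv_zero, zero_pow two_ne_zero]
      refine Real.sSup_of_not_bddAbove fun ⟨m, hm⟩ => ?_
      have := hm (hmem (max m 0 + 1) (by positivity) (by rw [← h0]; norm_num))
      linarith [le_max_left m 0]
    · rw [inv_pow]
      have hlt : ∀ β, β < (A ^ 2)⁻¹ ↔ β * A ^ 2 < 1 := fun β => by
        rw [← one_div, lt_div_iff₀ (by positivity)]
      refine IsLUB.csSup_eq ⟨fun β hβ => ?_, fun b hb => ?_⟩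
        ⟨(A ^ 2)⁻¹ / 2, hmem _ (by positivity) ((hlt _).1 (half_lt_self (by positivity)))⟩
      · rw [← one_div, le_div_iff₀ (by positivity)]
        exact hle β hβ
      · refine le_of_forall_lt_imp_le_of_dense fun β hβ => ?_
        rcases le_or_gt β 0 with hβ0 | hβ0
        · have hp : 0 < (A ^ 2)⁻¹ / 2 := by positivity
          exact (hβ0.trans hp.le).trans (hb (hmem _ hp ((hlt _).1 (half_lt_self (by positivity)))))
        · exact hb (hmem β hβ0 ((hlt β).1 hβ))
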